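/- Let G be an infinite group generated by a finite, symmetric set X, and let ω be a weight on G. Define τₙ = min_{u ∈ Sₙ} ω(u), where Sₙ is the set of elements of G of word length exactly n with respect to X. If the augmentation ideal ℓ¹₀(G, ω) is finitely-generated as a left ideal of ℓ¹(G, ω), then the sequence (τₙ) is tail-preserving. -/

import Mathlib

noncomputable section

open scoped BigOperators

variable {G : Type*}

/-- Convolution of two functions on a (discrete) group:
`(f ∗ g)(u) = ∑_{st = u} f(s) g(t)`. -/
def conv [Mul G] (f g : G → ℂ) : G → ℂ :=
  fun u => ∑' p : {p : G × G // p.1 * p.2 = u}, f (p : G × G).1 * g (p : G × G).2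

/-- The weighted space `ℓ¹(G, ω)`, as a set of functions `G → ℂ`. -/
def l1w (ω : G → ℝ) : Set (G → ℂ) := {f | Summable fun u => ‖f u‖ * ω u}

/-- The augmentation ideal `ℓ¹₀(G, ω) = {f ∈ ℓ¹(G, ω) : ∑_u f(u) = 0}`. -/
def l1w0 (ω : G → ℝ) : Set (G → ℂ) := {f ∈ l1w ω | ∑' u, f u = 0}

/-- `ω` is a weight on the group `G`. -/
def IsWeight [Monoid G] (ω : G → ℝ) : Prop :=
  (∀ u, 1 ≤ ω u) ∧ ω 1 = 1 ∧ ∀ u v, ω (u * v) ≤ ω u * ω v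

/-- `I` is finitely generated as a left ideal of `ℓ¹(G, ω)`:
`I = A♯x₁ + ⋯ + A♯xₙ` for some `x₁, …, xₙ ∈ A = ℓ¹(G, ω)`, where `A♯` is the
(conditional) unitisation, so `A♯x = {a ∗ x + c x : a ∈ A, c ∈ ℂ}`;
no closure is taken. -/
def IsFinGenLeftIdealOf [Mul G] (ω : G → ℝ) (I : Set (G → ℂ)) : Prop :=
  ∃ (n : ℕ) (x : Fin n → (G → ℂ)), (∀ i, x i ∈ l1w ω) ∧
    I = {f | ∃ (a : Fin n → (G → ℂ)) (c : Fin n → ℂ), (∀ i, a i ∈ l1w ω) ∧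
          f = ∑ i, (conv (a i) (x i) + c i • x i)}

/-- The word length of `u` with respect to a (symmetric) generating set `X`. -/
def wordLength [Monoid G] (X : Set G) (u : G) : ℕ :=
  sInf {n | ∃ l : List G, l.length = n ∧ (∀ x ∈ l, x ∈ X) ∧ l.prod = u}

/-- The tail `∑_{j=n+1}^∞ x_j` of a sequence, in 0-indexed form. -/
def tailFrom (x : ℕ → ℂ) (n : ℕ) : ℂ := ∑' j : ℕ, x (n + 1 + j)

/-- A sequence `τ` in `[1,∞)` is tail-preserving if for every complex sequence `x` with
`∑ τₙ|xₙ| < ∞` one has `∑ τₙ|∑_{j>n} x_j| < ∞`.  (0-indexed: `τ n` is the paper's `τ_{n+1}`.) -/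
def TailPreserving (τ : ℕ → ℝ) : Prop :=
  ∀ x : ℕ → ℂ, Summable (fun n => τ n * ‖x n‖) →
    Summable (fun n => τ n * ‖tailFrom x n‖)

section WordLength
variable [Group G] {X : Finset G}

lemma exists_word (hXsym : ∀ x ∈ X, x⁻¹ ∈ X) (hXgen : Subgroup.closure (X : Set G) = ⊤) (u : G) :
    ∃ l : List G, l.length = wordLength (X : Set G) u ∧ (∀ x ∈ l, x ∈ X) ∧ l.prod = u := by
  have h : {n | ∃ l : List G, l.length = n ∧ (∀ x ∈ l, x ∈ (X : Set G)) ∧ l.prod = u}.Nonempty := by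
    have hu : u ∈ Subgroup.closure (X : Set G) := by rw [hXgen]; trivial
    induction hu using Subgroup.closure_induction with
    | mem x hx => exact ⟨1, [x], by simp, by simpa using hx, by simp⟩
    | one => exact ⟨0, [], by simp⟩
    | mul x y _ _ h1 h2 =>
      obtain ⟨_, l1, -, h1, rfl⟩ := h1
      obtain ⟨_, l2, -, h2, rfl⟩ := h2
      refine ⟨_, l1 ++ l2, rfl, ?_, by simp⟩
      intro x hx
      rcases List.mem_append.1 hx with h | h
      · exact h1 x h
      · exact h2 x h
    | inv x _ h1 =>
      obtain ⟨_, l1, -, h1, rfl⟩ := h1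
      refine ⟨_, (l1.map (·⁻¹)).reverse, rfl, ?_, (List.prod_inv_reverse l1).symm⟩
      intro x hx
      simp only [List.mem_reverse, List.mem_map] at hx
      obtain ⟨a, ha, rfl⟩ := hx
      exact hXsym a (h1 a ha)
  exact Nat.sInf_mem h

lemma wl_prod_le (l : List G) (hl : ∀ x ∈ l, x ∈ X) :
    wordLength (X : Set G) l.prod ≤ l.length :=
  Nat.sInf_le ⟨l, rfl, hl, rfl⟩

lemma wl_one : wordLength (X : Set G) (1 : G) = 0 := by
  have := wl_prod_le (X := X) [] (by simp)
  simpa using this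

lemma wl_mul_le (hXsym : ∀ x ∈ X, x⁻¹ ∈ X) (hXgen : Subgroup.closure (X : Set G) = ⊤)
    (u x : G) (hx : x ∈ X) :
    wordLength (X : Set G) (u * x) ≤ wordLength (X : Set G) u + 1 := by
  obtain ⟨l, h1, h2, h3⟩ := exists_word hXsym hXgen u
  have := wl_prod_le (X := X) (l ++ [x]) (by
    intro y hy
    rcases List.mem_append.1 hy with h | h
    · exact h2 y h
    · simp at h; exact h ▸ hx)
  simpa [h3, h1] using this

lemma wl_le_mul (hXsym : ∀ x ∈ X, x⁻¹ ∈ X) (hXgen : Subgroup.closure (X : Set G) = ⊤)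
    (u x : G) (hx : x ∈ X) :
    wordLength (X : Set G) u ≤ wordLength (X : Set G) (u * x) + 1 := by
  have := wl_mul_le hXsym hXgen (u * x) x⁻¹ (hXsym x hx)
  simpa using this

lemma wl_pred (hXsym : ∀ x ∈ X, x⁻¹ ∈ X) (hXgen : Subgroup.closure (X : Set G) = ⊤)
    (u : G) (n : ℕ) (hu : wordLength (X : Set G) u = n + 1) :
    ∃ x ∈ X, wordLength (X : Set G) (u * x⁻¹) = n := by
  obtain ⟨l, h1, h2, h3⟩ := exists_word hXsym hXgen u
  rcases List.eq_nil_or_concat l with rfl | ⟨l', x, rfl⟩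
  · simp at h1; omega
  · have hx : x ∈ X := h2 x (by simp)
    refine ⟨x, hx, ?_⟩
    have h4 : u * x⁻¹ = l'.prod := by rw [← h3]; simp
    have h5 := wl_prod_le (X := X) l' (fun y hy => h2 y (by simp [hy]))
    have h6 := wl_le_mul hXsym hXgen u x⁻¹ (hXsym x hx)
    rw [← h4] at h5
    simp at h1
    omega

lemma ball_finite (hXsym : ∀ x ∈ X, x⁻¹ ∈ X) (hXgen : Subgroup.closure (X : Set G) = ⊤)
    (n : ℕ) : {u : G | wordLength (X : Set G) u ≤ n}.Finite := by
  induction n with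
  | zero =>
    refine (Set.finite_singleton (1 : G)).subset ?_
    intro u hu
    obtain ⟨l, h1, h2, h3⟩ := exists_word hXsym hXgen u
    have : l.length = 0 := by
      have : wordLength (X : Set G) u ≤ 0 := hu
      omega
    rw [List.length_eq_zero_iff] at this
    subst this
    simpa using h3.symm
  | succ n ih =>
    refine (ih.union (Set.Finite.image2 (fun a b => a * b) ih X.finite_toSet)).subset ?_
    intro u hu
    rcases Nat.lt_or_ge n (wordLength (X : Set G) u) with h | h
    · right
      have hu' : wordLength (X : Set G) u ≤ n + 1 := hu
      obtain ⟨x, hx, hux⟩ := wl_pred hXsym hXgen u n (by omega)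
      exact ⟨u * x⁻¹, by simp [hux], x, hx, by simp⟩
    · left; exact h

lemma sphere_nonempty [Infinite G] (hXsym : ∀ x ∈ X, x⁻¹ ∈ X)
    (hXgen : Subgroup.closure (X : Set G) = ⊤) (n : ℕ) :
    ∃ u : G, wordLength (X : Set G) u = n := by
  have key : ∀ k n (u : G), wordLength (X : Set G) u = n + k →
      ∃ u : G, wordLength (X : Set G) u = n := by
    intro k
    induction k with
    | zero => intro n u hu; exact ⟨u, hu⟩
    | succ k ih =>
      intro n u hu
      obtain ⟨x, -, h⟩ := wl_pred hXsym hXgen u (n + k) (by omega)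
      exact ih n _ h
  by_contra! hne
  have hfin := ball_finite hXsym hXgen n
  refine Set.infinite_univ (α := G) (hfin.subset ?_)
  intro u _
  by_contra h
  have h' : n < wordLength (X : Set G) u := by simpa using h
  obtain ⟨v, hv⟩ := key (wordLength (X : Set G) u - n) n u (by omega)
  exact hne v hv

end WordLength

section Ops
set_option linter.unusedSectionVars false

/-- plain `ℓ¹(G)`, used as the model of `ℓ¹(G, ω)` after rescaling by `ω`. -/
abbrev L1 (G : Type*) := lp (fun _ : G => ℂ) 1

lemma L1.summable (a : L1 G) : Summable fun u => ‖a u‖ := by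
  have := (memℓp_gen_iff (p := 1) (by simp)).1 a.2
  simpa using this

lemma L1.norm_eq (a : L1 G) : ‖a‖ = ∑' u, ‖a u‖ := by
  have := lp.norm_eq_tsum_rpow (p := 1) (by simp) a
  simpa using this

/-- build an element of `ℓ¹` -/
def L1.mk (f : G → ℂ) (hf : Summable fun u => ‖f u‖) : L1 G :=
  ⟨f, memℓp_gen (p := 1) (by simpa using hf)⟩

@[simp] lemma L1.mk_apply (f : G → ℂ) (hf : Summable fun u => ‖f u‖) (u : G) :
    L1.mk f hf u = f u := rfl

lemma L1.summable_mul (g : G → ℂ) (hg : ∀ u, ‖g u‖ ≤ 1) (a : L1 G) :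
    Summable fun u => ‖a u * g u‖ := by
  refine Summable.of_nonneg_of_le (fun _ => norm_nonneg _) (fun u => ?_) (L1.summable a)
  rw [norm_mul]
  exact mul_le_of_le_one_right (norm_nonneg _) (hg u)

/-- the functional on `ℓ¹` given by a bounded function -/
def func (g : G → ℂ) (hg : ∀ u, ‖g u‖ ≤ 1) : L1 G →L[ℂ] ℂ :=
  LinearMap.mkContinuous
    { toFun := fun a => ∑' u, a u * g u
      map_add' := by
        intro a b
        rw [← Summable.tsum_add (L1.summable_mul g hg a).of_norm (L1.summable_mul g hg b).of_norm]
        exact tsum_congr fun u => by simp [add_mul]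
      map_smul' := by
        intro c a
        simp only [RingHom.id_apply, smul_eq_mul]
        rw [← tsum_mul_left]
        exact tsum_congr fun u => by simp [mul_assoc] } 1 (by
      intro a
      rw [one_mul, L1.norm_eq]
      refine (norm_tsum_le_tsum_norm (L1.summable_mul g hg a)).trans ?_
      refine (L1.summable_mul g hg a).tsum_le_tsum (fun u => ?_) (L1.summable a)
      rw [norm_mul]
      exact mul_le_of_le_one_right (norm_nonneg _) (hg u))

lemma func_apply (g : G → ℂ) (hg : ∀ u, ‖g u‖ ≤ 1) (a : L1 G) :
    func g hg a = ∑' u, a u * g u := rfl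

variable [Group G] {ω : G → ℝ}

lemma IsWeight.pos (hω : IsWeight ω) (u : G) : 0 < ω u := zero_lt_one.trans_le (hω.1 u)

lemma IsWeight.ne (hω : IsWeight ω) (u : G) : (ω u : ℂ) ≠ 0 := by
  exact_mod_cast (hω.pos u).ne'

lemma tr_bound (hω : IsWeight ω) (t : G) (a : L1 G) (u : G) :
    ‖a (u * t⁻¹) * (ω u / ω (u * t⁻¹))‖ ≤ ω t * ‖a (u * t⁻¹)‖ := by
  rw [norm_mul, norm_div, mul_comm]
  refine mul_le_mul_of_nonneg_right ?_ (norm_nonneg _)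
  have h1 := hω.pos (u * t⁻¹)
  rw [Complex.norm_real, Complex.norm_real, Real.norm_of_nonneg (hω.pos u).le,
    Real.norm_of_nonneg h1.le, div_le_iff₀ h1]
  have := hω.2.2 (u * t⁻¹) t
  simp only [inv_mul_cancel_right] at this
  linarith

lemma tr_summable' (t : G) (a : L1 G) : Summable fun u => ‖a (u * t⁻¹)‖ :=
  (Equiv.mulRight t⁻¹).summable_iff.2 (L1.summable a)

lemma tr_summable (hω : IsWeight ω) (t : G) (a : L1 G) :
    Summable fun u => ‖a (u * t⁻¹) * (ω u / ω (u * t⁻¹))‖ :=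
  Summable.of_nonneg_of_le (fun _ => norm_nonneg _) (tr_bound hω t a)
    ((tr_summable' t a).mul_left _)

/-- right translation, rescaled -/
def tr (hω : IsWeight ω) (t : G) : L1 G →L[ℂ] L1 G :=
  LinearMap.mkContinuous
    { toFun := fun a => L1.mk (fun u => a (u * t⁻¹) * (ω u / ω (u * t⁻¹))) (tr_summable hω t a)
      map_add' := by
        intro a b
        ext u
        simp [add_mul]
      map_smul' := by
        intro c a
        ext u
        simp [mul_assoc] } (ω t) (by
      intro a
      rw [L1.norm_eq, L1.norm_eq, ← tsum_mul_left]
      refine ((tr_summable hω t a).tsum_le_tsum (tr_bound hω t a)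
        ((tr_summable' t a).mul_left _)).trans_eq ?_
      exact (Equiv.mulRight t⁻¹).tsum_eq (fun u => ω t * ‖a u‖))

lemma tr_apply (hω : IsWeight ω) (t : G) (a : L1 G) (u : G) :
    tr hω t a u = a (u * t⁻¹) * (ω u / ω (u * t⁻¹)) := rfl

lemma tr_norm (hω : IsWeight ω) (t : G) : ‖tr hω t‖ ≤ ω t :=
  LinearMap.mkContinuous_norm_le _ (hω.pos t).le _

lemma tr_one (hω : IsWeight ω) (a : L1 G) : tr hω 1 a = a := by
  ext u
  rw [tr_apply]
  simp [hω.ne u]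

lemma tr_mul (hω : IsWeight ω) (s t : G) (a : L1 G) : tr hω (s * t) a = tr hω t (tr hω s a) := by
  ext u
  simp only [tr_apply, mul_inv_rev, mul_assoc]
  congr 1
  have h1 := hω.ne u
  have h2 := hω.ne (u * t⁻¹)
  have h3 := hω.ne (u * (t⁻¹ * s⁻¹))
  field_simp

lemma inv_norm_le (hω : IsWeight ω) (u : G) : ‖((ω u : ℂ))⁻¹‖ ≤ 1 := by
  rw [norm_inv, Complex.norm_real, Real.norm_of_nonneg (hω.pos u).le]
  exact inv_le_one_of_one_le₀ (hω.1 u)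

/-- the augmentation functional -/
def aug (hω : IsWeight ω) : L1 G →L[ℂ] ℂ := func (fun u => (ω u : ℂ)⁻¹) (inv_norm_le hω)

lemma aug_tr (hω : IsWeight ω) (t : G) (a : L1 G) : aug hω (tr hω t a) = aug hω a := by
  simp only [aug, func_apply, tr_apply]
  rw [← (Equiv.mulRight t⁻¹).tsum_eq (fun u => a u * (ω u : ℂ)⁻¹)]
  refine tsum_congr fun u => ?_
  have h1 := hω.ne u
  have h2 := hω.ne (u * t⁻¹)
  simp only [Equiv.coe_mulRight]
  field_simp

/-- the augmentation ideal in rescaled form -/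
def augK (hω : IsWeight ω) : Submodule ℂ (L1 G) := LinearMap.ker (aug hω).toLinearMap

instance augK_complete (hω : IsWeight ω) : CompleteSpace (augK hω) :=
  (ContinuousLinearMap.isClosed_ker (aug hω)).completeSpace_coe

lemma mem_augK (hω : IsWeight ω) (a : L1 G) : a ∈ augK hω ↔ aug hω a = 0 := Iff.rfl

/-- the operator `R_t - 1` as a map to the augmentation ideal -/
def dif (hω : IsWeight ω) (t : G) : L1 G →L[ℂ] augK hω :=
  (tr hω t - ContinuousLinearMap.id ℂ (L1 G)).codRestrict (augK hω) (by
    intro a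
    rw [mem_augK]
    simp [aug_tr])

lemma dif_apply (hω : IsWeight ω) (t : G) (a : L1 G) :
    (dif hω t a : L1 G) = tr hω t a - a := rfl

lemma dif_norm (hω : IsWeight ω) (t : G) : ‖dif hω t‖ ≤ 2 * ω t := by
  refine ContinuousLinearMap.opNorm_le_bound _ (by have := hω.pos t; positivity) (fun a => ?_)
  rw [Submodule.coe_norm, dif_apply]
  have h1 := (tr hω t).le_of_opNorm_le (tr_norm hω t) a
  have h2 := norm_sub_le (tr hω t a) a
  have h3 : ‖a‖ ≤ ω t * ‖a‖ := le_mul_of_one_le_left (norm_nonneg _) (hω.1 t)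
  linarith

lemma gen_summable {Y : Type*} [NormedAddCommGroup Y] [NormedSpace ℂ Y] [CompleteSpace Y]
    (d : G → Y) (hd : ∀ t, ‖d t‖ ≤ 2 * ω t) (x : G → ℂ) (hx : x ∈ l1w ω) :
    Summable fun t => x t • d t := by
  have hx' : Summable fun u => ‖x u‖ * ω u := hx
  refine Summable.of_norm_bounded (hx'.mul_left 2) (fun t => ?_)
  calc ‖x t • d t‖ ≤ ‖x t‖ * ‖d t‖ := norm_smul_le _ _
    _ ≤ ‖x t‖ * (2 * ω t) := mul_le_mul_of_nonneg_left (hd t) (norm_nonneg (x t))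
    _ = 2 * (‖x t‖ * ω t) := by ring

lemma dif_summable (hω : IsWeight ω) (x : G → ℂ) (hx : x ∈ l1w ω) :
    Summable fun t => x t • dif hω t :=
  gen_summable (Y := L1 G →L[ℂ] augK hω) (dif hω) (dif_norm hω) x hx

/-- basis vectors -/
def bas (ω : G → ℝ) (u : G) : L1 G :=
  open Classical in lp.single 1 u (ω u : ℂ)

lemma bas_norm (hω : IsWeight ω) (u : G) : ‖bas ω u‖ = ω u := by
  classical
  rw [bas, lp.norm_single (by simp), Complex.norm_real, Real.norm_of_nonneg (hω.pos u).le]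

lemma func_bas (g : G → ℂ) (hg : ∀ u, ‖g u‖ ≤ 1) (u : G) : func g hg (bas ω u) = ω u * g u := by
  classical
  rw [func_apply, tsum_eq_single u]
  · simp [bas, lp.single_apply]
  · intro v hv
    simp [bas, lp.single_apply, hv]

lemma conv_eq (f g : G → ℂ) (u : G) : conv f g u = ∑' t, f (u * t⁻¹) * g t := by
  let e : G ≃ {p : G × G // p.1 * p.2 = u} :=
    { toFun := fun t => ⟨(u * t⁻¹, t), by simp⟩
      invFun := fun p => p.1.2
      left_inv := fun t => rfl
      right_inv := by
        rintro ⟨⟨s, t⟩, h⟩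
        simp only [Subtype.mk.injEq, Prod.mk.injEq, and_true]
        rw [← h]; simp }
  rw [conv, ← e.tsum_eq]
  rfl

/-- coordinate evaluation as a functional -/
def evc (u : G) : L1 G →L[ℂ] ℂ :=
  lp.evalCLM ℂ (fun _ : G => ℂ) 1 u

lemma evc_apply (u : G) (a : L1 G) : evc u a = a u := rfl

lemma bas_apply_self (u : G) : bas ω u u = ω u := by
  simp [bas]

lemma bas_apply_ne (u v : G) (h : v ≠ u) : bas ω u v = 0 := by
  simp [bas, h]

/-- convolution by `x` as an operator -/
def cop (hω : IsWeight ω) (x : G → ℂ) : L1 G →L[ℂ] augK hω := ∑' t, x t • dif hω t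

lemma summable_of_l1w (hω : IsWeight ω) (x : G → ℂ) (hx : x ∈ l1w ω) : Summable x := by
  have hx' : Summable fun u => ‖x u‖ * ω u := hx
  exact Summable.of_norm_bounded hx' fun t => le_mul_of_one_le_right (norm_nonneg _) (hω.1 t)

lemma lift_summable (hω : IsWeight ω) (a : G → ℂ) (ha : a ∈ l1w ω) :
    Summable fun u => ‖a u * (ω u : ℂ)‖ := by
  have ha' : Summable fun u => ‖a u‖ * ω u := ha
  refine ha'.congr fun u => ?_
  rw [norm_mul, Complex.norm_real, Real.norm_of_nonneg (hω.pos u).le]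

lemma cop_apply (hω : IsWeight ω) (x : G → ℂ) (hx : x ∈ l1w0 ω) (a : G → ℂ) (ha : a ∈ l1w ω)
    (c : ℂ) (u : G) :
    (cop hω x (L1.mk (fun u => a u * (ω u : ℂ)) (lift_summable hω a ha) + c • bas ω 1) : L1 G) u
      = (conv a x u + c * x u) * ω u := by
  classical
  set A := L1.mk (fun u => a u * (ω u : ℂ)) (lift_summable hω a ha) + c • bas ω 1 with hA
  have h1 := (dif_summable hω x hx.1).hasSum
  have h2 := h1.mapL (((evc u).comp (augK hω).subtypeL).comp
    (ContinuousLinearMap.apply ℂ (augK hω) A))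
  have h3 : HasSum (fun t => x t * A u) 0 := by
    have := (summable_of_l1w hω x hx.1).hasSum
    rw [hx.2] at this
    simpa using this.mul_right (A u)
  have h4 := h2.add h3
  have h5 : HasSum (fun t => (x t * if u = t then c else 0) * (ω u : ℂ)) (x u * c * ω u) := by
    have := hasSum_single (f := fun t => (x t * if u = t then c else 0) * (ω u : ℂ)) u (by
      intro t ht
      simp [ht.symm])
    simpa using this
  have h6 := h4.sub h5
  have h7 : HasSum (fun t => a (u * t⁻¹) * x t * (ω u : ℂ))
      ((cop hω x A : L1 G) u + 0 - x u * c * ω u) := by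
    refine (congrArg (fun f : G → ℂ => HasSum f ((cop hω x A : L1 G) u + 0 - x u * c * ω u))
      (funext fun t => ?_)).mpr h6
    have e1 : (((evc u).comp (augK hω).subtypeL).comp
      (ContinuousLinearMap.apply ℂ (augK hω) A)) (x t • dif hω t) = x t * (tr hω t A u - A u) := by
      rfl
    have e2 : A (u * t⁻¹) = (a (u * t⁻¹) + if u = t then c else 0) * ω (u * t⁻¹) := by
      have e3 : A (u * t⁻¹) = a (u * t⁻¹) * ω (u * t⁻¹) + c * bas ω 1 (u * t⁻¹) := rfl
      rw [e3]
      by_cases h : u = t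
      · subst h
        rw [mul_inv_cancel, bas_apply_self]
        simp [add_mul]
      · have : u * t⁻¹ ≠ 1 := by rwa [Ne, mul_inv_eq_one]
        simp [bas_apply_ne _ _ this, h]
    rw [e1, tr_apply, e2]
    have h1 := hω.ne u
    have h2 := hω.ne (u * t⁻¹)
    field_simp
    ring
  have h8 := h7.tsum_eq
  rw [tsum_mul_right, ← conv_eq] at h8
  linear_combination -h8

end Ops

section Surj
set_option linter.unusedSectionVars false

/-- A continuous linear map close to a surjective one is surjective. -/
lemma surj_of_tendsto {E F ι : Type*} [NormedAddCommGroup E] [NormedSpace ℂ E] [CompleteSpace E]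
    [NormedAddCommGroup F] [NormedSpace ℂ F] [CompleteSpace F] {l : Filter ι} [l.NeBot]
    (T : E →L[ℂ] F) (S : ι → E →L[ℂ] F) (hS : Filter.Tendsto S l (nhds T))
    (hT : Function.Surjective T) : ∃ i, Function.Surjective (S i) := by
  have hr : T.range = ⊤ := LinearMap.range_eq_top.2 hT
  set N := T.nonlinearRightInverseOfSurjective hr with hN
  have hpos : 0 < N.nnnorm := T.nonlinearRightInverseOfSurjective_nnnorm_pos hr
  have hev : ∀ᶠ i in l, dist (S i) T < (N.nnnorm : ℝ)⁻¹ :=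
    (Metric.tendsto_nhds.1 hS) _ (by positivity)
  obtain ⟨i, hi⟩ := hev.exists
  refine ⟨i, fun y => ?_⟩
  rw [dist_eq_norm] at hi
  have happ : ApproximatesLinearOn (S i) T Set.univ ‖S i - T‖₊ := by
    intro x _ y _
    have := (S i - T).le_opNorm (x - y)
    simpa [sub_sub_sub_comm] using this
  set δ := (N.nnnorm : ℝ)⁻¹ - ‖S i - T‖ with hδ
  have hδpos : 0 < δ := sub_pos.2 hi
  have := happ.surjOn_closedBall_of_nonlinearRightInverse N (ε := ‖y‖ / δ) (b := 0)
    (by positivity) (Set.subset_univ _)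
  have hy : y ∈ Metric.closedBall (S i 0) (((N.nnnorm : ℝ)⁻¹ - ‖S i - T‖₊) * (‖y‖ / δ)) := by
    rw [map_zero, mem_closedBall_zero_iff, coe_nnnorm, ← hδ, mul_div_cancel₀ _ hδpos.ne']
  obtain ⟨x, -, hx⟩ := this hy
  exact ⟨x, hx⟩

variable [Group G] {ω : G → ℝ}

lemma gen_mem (n : ℕ) (x : Fin n → (G → ℂ)) (i : Fin n) :
    ∃ (a : Fin n → (G → ℂ)) (c : Fin n → ℂ), (∀ i, a i ∈ l1w ω) ∧
          x i = ∑ i, (conv (a i) (x i) + c i • x i) := by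
  classical
  refine ⟨fun _ => 0, Pi.single i 1, fun _ => ?_, ?_⟩
  · simp [l1w]
  · have h0 : ∀ g : G → ℂ, conv (0 : G → ℂ) g = 0 := by
      intro g; funext u; simp [conv]
    rw [Finset.sum_eq_single i]
    · simp [h0]
    · intro j _ hj
      simp [h0, hj]
    · simp

lemma exists_fin_rep (hω : IsWeight ω) (hfg : IsFinGenLeftIdealOf ω (l1w0 ω)) :
    ∃ (n : ℕ) (x : Fin n → G → ℂ) (F : Finset G), ∀ f : L1 G, aug hω f = 0 →
      ∃ a : Fin n → L1 G, f = ∑ i, ∑ t ∈ F, x i t • (tr hω t (a i) - a i) := by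
  obtain ⟨n, x, hx, hI⟩ := hfg
  have hx0 : ∀ i, x i ∈ l1w0 ω := by
    intro i
    rw [hI]
    exact gen_mem n x i
  refine ⟨n, x, ?_⟩
  let T : (Fin n → L1 G) →L[ℂ] augK hω :=
    ∑ i, (cop hω (x i)).comp (ContinuousLinearMap.proj i)
  let S : Finset G → (Fin n → L1 G) →L[ℂ] augK hω := fun F =>
    ∑ i, (∑ t ∈ F, x i t • dif hω t).comp (ContinuousLinearMap.proj i)
  have hS : Filter.Tendsto S Filter.atTop (nhds T) := by
    refine tendsto_finsetSum _ fun i _ => ?_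
    have h1 : Filter.Tendsto (fun F : Finset G => ∑ t ∈ F, x i t • dif hω t) Filter.atTop
        (nhds (cop hω (x i))) := (dif_summable hω (x i) (hx i)).hasSum
    have h2 : Continuous fun R : L1 G →L[ℂ] augK hω =>
        R.comp (ContinuousLinearMap.proj (R := ℂ) (φ := fun _ : Fin n => L1 G) i) := by
      fun_prop
    exact (h2.tendsto _).comp h1
  have hT : Function.Surjective T := by
    intro f
    have hf : (fun u => (f : L1 G) u / ω u) ∈ l1w0 ω := by
      refine ⟨?_, ?_⟩
      · refine (L1.summable (f : L1 G)).congr fun u => ?_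
        rw [norm_div, Complex.norm_real, Real.norm_of_nonneg (hω.pos u).le,
          div_mul_cancel₀ _ (hω.pos u).ne']
      · have := f.2
        rw [mem_augK, aug, func_apply] at this
        simpa [div_eq_mul_inv] using this
    rw [hI] at hf
    obtain ⟨a, c, ha, hfa⟩ := hf
    refine ⟨fun i => L1.mk (fun u => a i u * (ω u : ℂ)) (lift_summable hω (a i) (ha i))
      + c i • bas ω 1, ?_⟩
    apply Subtype.ext
    ext u
    have h1 := congrFun hfa u
    have h2 := hω.ne u
    rw [div_eq_iff h2] at h1
    rw [h1]
    simp only [T, ContinuousLinearMap.sum_apply, ContinuousLinearMap.comp_apply,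
      ContinuousLinearMap.proj_apply, Submodule.coe_sum, lp.coeFn_sum, Finset.sum_apply]
    rw [Finset.sum_mul]
    refine Finset.sum_congr rfl fun i _ => ?_
    rw [cop_apply hω (x i) (hx0 i) (a i) (ha i)]
    simp
  obtain ⟨F, hF⟩ := surj_of_tendsto T S hS hT
  refine ⟨F, fun f hf => ?_⟩
  obtain ⟨a, ha⟩ := hF ⟨f, (mem_augK hω f).2 hf⟩
  refine ⟨a, ?_⟩
  have := congrArg (fun z : augK hω => (z : L1 G)) ha
  simp only [S, ContinuousLinearMap.sum_apply, ContinuousLinearMap.comp_apply,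
      ContinuousLinearMap.proj_apply, Submodule.coe_sum, ContinuousLinearMap.smul_apply,
      Submodule.coe_smul, dif_apply] at this
  exact this.symm

end Surj

section Good
set_option linter.unusedSectionVars false
variable [Group G] {ω : G → ℝ} {X : Finset G}

/-- the sequence `τ` -/
def tau (X : Finset G) (ω : G → ℝ) (n : ℕ) : ℝ :=
  sInf (ω '' {u : G | wordLength (X : Set G) u = n + 1})

lemma tau_le (hω : IsWeight ω) (n : ℕ) (v : G) (hv : wordLength (X : Set G) v = n + 1) :
    tau X ω n ≤ ω v := by
  refine csInf_le ⟨1, ?_⟩ ⟨v, hv, rfl⟩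
  rintro _ ⟨u, -, rfl⟩
  exact hω.1 u

lemma tau_nonneg (hω : IsWeight ω) (n : ℕ) : 0 ≤ tau X ω n := by
  refine Real.sInf_nonneg ?_
  rintro _ ⟨u, -, rfl⟩
  exact (hω.pos u).le

/-- indicator over ω -/
def psiFun (X : Finset G) (ω : G → ℝ) (n : ℕ) (u : G) : ℂ :=
  if n + 1 < wordLength (X : Set G) u then (ω u : ℂ)⁻¹ else 0

lemma psiFun_le (hω : IsWeight ω) (n : ℕ) (u : G) : ‖psiFun X ω n u‖ ≤ 1 := by
  unfold psiFun
  split_ifs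
  · exact inv_norm_le hω u
  · simp

/-- the sum over the complement of a ball -/
def psi (X : Finset G) (hω : IsWeight ω) (n : ℕ) : L1 G →L[ℂ] ℂ :=
  func (psiFun X ω n) (psiFun_le hω n)

/-- tails are summable against `τ` -/
def Good (X : Finset G) (hω : IsWeight ω) (a : L1 G) : Prop :=
  Summable fun n => tau X ω n * ‖psi X hω n a‖

lemma Good.add {hω : IsWeight ω} {a b : L1 G} (ha : Good X hω a) (hb : Good X hω b) :
    Good X hω (a + b) := by
  refine Summable.of_nonneg_of_le (fun n => mul_nonneg (tau_nonneg hω n) (norm_nonneg _))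
    (fun n => ?_) (Summable.add ha hb)
  rw [map_add, ← mul_add]
  exact mul_le_mul_of_nonneg_left (norm_add_le _ _) (tau_nonneg hω n)

lemma Good.smul {hω : IsWeight ω} {a : L1 G} (ha : Good X hω a) (c : ℂ) :
    Good X hω (c • a) := by
  refine (Summable.mul_left ‖c‖ ha).congr fun n => ?_
  rw [map_smul, norm_smul]
  ring

lemma Good.zero {hω : IsWeight ω} : Good X hω 0 := by
  simp [Good, summable_zero]

lemma Good.sum {hω : IsWeight ω} {ι : Type*} (s : Finset ι) (a : ι → L1 G)
    (h : ∀ i ∈ s, Good X hω (a i)) : Good X hω (∑ i ∈ s, a i) := by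
  classical
  induction s using Finset.induction_on with
  | empty => simpa using Good.zero
  | insert i s hi ih =>
    rw [Finset.sum_insert hi]
    exact (h i (by simp)).add (ih fun j hj => h j (by simp [hj]))

lemma psi_tr (hω : IsWeight ω) (n : ℕ) (t : G) (a : L1 G) :
    psi X hω n (tr hω t a) =
      ∑' v, a v * (if n + 1 < wordLength (X : Set G) (v * t) then (ω v : ℂ)⁻¹ else 0) := by
  rw [psi, func_apply, ← (Equiv.mulRight t).tsum_eq]
  refine tsum_congr fun v => ?_
  have h1 := hω.ne v
  have h2 := hω.ne (v * t)
  simp only [Equiv.coe_mulRight, tr_apply, mul_inv_cancel_right]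
  by_cases h : n + 1 < wordLength (X : Set G) (v * t)
  · have e : psiFun X ω n (v * t) = (ω (v * t) : ℂ)⁻¹ := if_pos h
    rw [e, if_pos h]
    field_simp
  · have e : psiFun X ω n (v * t) = 0 := if_neg h
    rw [e, if_neg h]
    simp

/-- indicator of two consecutive spheres -/
def ind (X : Finset G) (n : ℕ) (v : G) : ℝ :=
  (if wordLength (X : Set G) v = n + 1 then 1 else 0) +
  (if wordLength (X : Set G) v = n + 2 then 1 else 0)

lemma ind_nonneg (n : ℕ) (v : G) : 0 ≤ ind X n v := by
  unfold ind; split_ifs <;> norm_num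

lemma ind_sum (N : ℕ) (v : G) : ∑ n ∈ Finset.range N, ind X n v ≤ 2 := by
  have key : ∀ k j : ℕ, ∑ n ∈ Finset.range N, (if k = n + j then (1 : ℝ) else 0) ≤ 1 := by
    intro k j
    rw [Finset.sum_boole]
    have : ({n ∈ Finset.range N | k = n + j}).card ≤ 1 := by
      rw [Finset.card_le_one]
      intro a ha b hb
      simp at ha hb
      omega
    exact_mod_cast this
  unfold ind
  rw [Finset.sum_add_distrib]
  linarith [key (wordLength (X : Set G) v) 1, key (wordLength (X : Set G) v) 2]

lemma ind_summable (n : ℕ) (a : L1 G) : Summable fun v => ‖a v‖ * ind X n v := by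
  refine Summable.of_nonneg_of_le (fun v => mul_nonneg (norm_nonneg _) (ind_nonneg n v))
    (fun v => ?_) ((L1.summable a).mul_right 2)
  refine mul_le_mul_of_nonneg_left ?_ (norm_nonneg _)
  unfold ind; split_ifs <;> norm_num

lemma tau_bound (hXsym : ∀ x ∈ X, x⁻¹ ∈ X) (hXgen : Subgroup.closure (X : Set G) = ⊤)
    (hω : IsWeight ω) (n : ℕ) (v : G)
    (hv : wordLength (X : Set G) v = n + 1 ∨ wordLength (X : Set G) v = n + 2) :
    tau X ω n ≤ (1 + ∑ y ∈ X, ω y⁻¹) * ω v := by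
  have hp := hω.pos v
  have hs : 0 ≤ ∑ y ∈ X, ω y⁻¹ := Finset.sum_nonneg fun y _ => (hω.pos _).le
  rcases hv with hv | hv
  · have := tau_le hω n v hv
    nlinarith
  · obtain ⟨x, hx, h⟩ := wl_pred hXsym hXgen v (n + 1) hv
    have h1 := tau_le hω n _ h
    have h2 := hω.2.2 v x⁻¹
    have h3 : ω x⁻¹ ≤ ∑ y ∈ X, ω y⁻¹ :=
      Finset.single_le_sum (f := fun y => ω y⁻¹) (fun y _ => (hω.pos _).le) hx
    nlinarith

lemma good_gen (hXsym : ∀ x ∈ X, x⁻¹ ∈ X) (hXgen : Subgroup.closure (X : Set G) = ⊤)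
    (hω : IsWeight ω) (x : G) (hx : x ∈ X) (a : L1 G) : Good X hω (tr hω x a - a) := by
  set C := 1 + ∑ y ∈ X, ω y⁻¹ with hC
  have hC0 : 0 ≤ C := add_nonneg zero_le_one (Finset.sum_nonneg fun y _ => (hω.pos _).le)
  have hb : ∀ n, tau X ω n * ‖psi X hω n (tr hω x a - a)‖ ≤ C * ∑' v, ‖a v‖ * ind X n v := by
    intro n
    have hg1 : ∀ v, ‖(if n + 1 < wordLength (X : Set G) (v * x) then (ω v : ℂ)⁻¹ else 0)‖ ≤ 1 := by
      intro v
      split_ifs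
      · exact inv_norm_le hω v
      · simp
    rw [map_sub, psi_tr, psi, func_apply,
      ← (L1.summable_mul _ hg1 a).of_norm.tsum_sub
        (L1.summable_mul _ (psiFun_le hω n) a).of_norm, ← tsum_mul_left]
    have hpt : ∀ v, tau X ω n *
        ‖a v * (if n + 1 < wordLength (X : Set G) (v * x) then (ω v : ℂ)⁻¹ else 0)
          - a v * psiFun X ω n v‖ ≤ C * (‖a v‖ * ind X n v) := by
      intro v
      have h1 := wl_mul_le hXsym hXgen v x hx
      have h2 := wl_le_mul hXsym hXgen v x hx
      by_cases hv : wordLength (X : Set G) v = n + 1 ∨ wordLength (X : Set G) v = n + 2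
      · have hi : ind X n v = 1 := by
          unfold ind
          rcases hv with hv | hv <;> simp [hv]
        rw [hi, mul_one, ← mul_sub, norm_mul]
        have h3 : ‖(if n + 1 < wordLength (X : Set G) (v * x) then (ω v : ℂ)⁻¹ else 0)
            - psiFun X ω n v‖ ≤ (ω v)⁻¹ := by
          have hn : ‖((ω v : ℂ))⁻¹‖ = (ω v)⁻¹ := by
            rw [norm_inv, Complex.norm_real, Real.norm_of_nonneg (hω.pos v).le]
          have hp := inv_pos.2 (hω.pos v)
          unfold psiFun
          split_ifs <;> simp only [sub_self, sub_zero, zero_sub, norm_neg, norm_zero, hn, le_refl,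
            hp.le]
        have h4 : tau X ω n * (ω v)⁻¹ ≤ C := by
          rw [← div_eq_mul_inv, div_le_iff₀ (hω.pos v)]
          exact tau_bound hXsym hXgen hω n v hv
        have h5 := mul_le_mul_of_nonneg_left h3 (tau_nonneg (X := X) hω n)
        have h6 := mul_le_mul_of_nonneg_left (h5.trans h4) (norm_nonneg (a v))
        linarith
      · have : psiFun X ω n v =
            (if n + 1 < wordLength (X : Set G) (v * x) then (ω v : ℂ)⁻¹ else 0) := by
          unfold psiFun
          split_ifs <;> first | rfl | omega
        rw [this, sub_self, norm_zero, mul_zero]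
        exact mul_nonneg hC0 (mul_nonneg (norm_nonneg _) (ind_nonneg n v))
    have hsum : Summable fun v =>
        ‖a v * (if n + 1 < wordLength (X : Set G) (v * x) then (ω v : ℂ)⁻¹ else 0)
          - a v * psiFun X ω n v‖ := by
      refine Summable.of_nonneg_of_le (fun _ => norm_nonneg _) (fun v => norm_sub_le _ _)
        ((L1.summable_mul _ hg1 a).add (L1.summable_mul _ (psiFun_le (X := X) hω n) a))
    refine (mul_le_mul_of_nonneg_left (norm_tsum_le_tsum_norm hsum) (tau_nonneg hω n)).trans ?_
    rw [← tsum_mul_left]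
    exact (hsum.mul_left _).tsum_le_tsum hpt ((ind_summable n a).mul_left C)
  refine summable_of_sum_range_le (c := C * ∑' v, ‖a v‖ * 2)
    (fun n => mul_nonneg (tau_nonneg hω n) (norm_nonneg _)) fun N => ?_
  refine (Finset.sum_le_sum fun n _ => hb n).trans ?_
  rw [← Finset.mul_sum, ← Summable.tsum_finsetSum fun n _ => ind_summable n a]
  refine mul_le_mul_of_nonneg_left ?_ hC0
  refine (summable_sum fun n _ => ind_summable n a).tsum_le_tsum (fun v => ?_)
    ((L1.summable a).mul_right 2)
  rw [← Finset.mul_sum]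
  exact mul_le_mul_of_nonneg_left (ind_sum N v) (norm_nonneg _)

lemma good_all (hXsym : ∀ x ∈ X, x⁻¹ ∈ X) (hXgen : Subgroup.closure (X : Set G) = ⊤)
    (hω : IsWeight ω) (t : G) : ∀ a : L1 G, Good X hω (tr hω t a - a) := by
  have ht : t ∈ Subgroup.closure (X : Set G) := by rw [hXgen]; trivial
  induction ht using Subgroup.closure_induction with
  | mem x hx => exact good_gen hXsym hXgen hω x hx
  | one => intro a; rw [tr_one, sub_self]; exact Good.zero
  | mul s t _ _ hs ht =>
    intro a
    have := (ht (tr hω s a)).add (hs a)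
    rwa [← tr_mul, sub_add_sub_cancel] at this
  | inv s _ hs =>
    intro a
    have := (hs (tr hω s⁻¹ a)).smul (-1)
    rwa [← tr_mul, inv_mul_cancel, tr_one, neg_one_smul, neg_sub] at this

end Good

lemma final [Group G] [Infinite G] (X : Finset G)
    (hXsym : ∀ x ∈ X, x⁻¹ ∈ X) (hXgen : Subgroup.closure (X : Set G) = ⊤)
    (ω : G → ℝ) (hω : IsWeight ω)
    (hfg : IsFinGenLeftIdealOf ω (l1w0 ω)) : TailPreserving (tau X ω) := by
  intro y hy
  have hne : ∀ n, (ω '' {u : G | wordLength (X : Set G) u = n + 1}).Nonempty := by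
    intro n
    obtain ⟨u, hu⟩ := sphere_nonempty hXsym hXgen (n + 1)
    exact ⟨_, u, hu, rfl⟩
  have h1 : ∀ n, 1 ≤ tau X ω n := by
    intro n
    refine le_csInf (hne n) ?_
    rintro _ ⟨u, -, rfl⟩
    exact hω.1 u
  have hch : ∀ n, ∃ u : G, wordLength (X : Set G) u = n + 1 ∧ ω u ≤ 2 * tau X ω n := by
    intro n
    obtain ⟨_, ⟨u, hu, rfl⟩, h⟩ := exists_lt_of_csInf_lt (hne n)
      (show tau X ω n < 2 * tau X ω n by linarith [h1 n])
    exact ⟨u, hu, h.le⟩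
  choose u hu huω using hch
  have hys : Summable fun n => y n • bas ω (u n) := by
    refine Summable.of_norm_bounded (hy.mul_left 2) fun n => ?_
    rw [norm_smul, bas_norm hω]
    have := mul_le_mul_of_nonneg_left (huω n) (norm_nonneg (y n))
    linarith
  have hy1 : Summable y := by
    refine Summable.of_norm_bounded hy fun n => ?_
    exact le_mul_of_one_le_left (norm_nonneg _) (h1 n)
  set f : L1 G := ∑' n, y n • bas ω (u n) - (∑' n, y n) • bas ω 1 with hf
  have haug : aug hω f = 0 := by
    rw [hf, map_sub, ContinuousLinearMap.map_tsum _ hys]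
    simp only [map_smul, aug, func_bas, smul_eq_mul]
    have : ∀ v, (ω v : ℂ) * (ω v : ℂ)⁻¹ = 1 := fun v => mul_inv_cancel₀ (hω.ne v)
    simp [this]
  have hpsi : ∀ n, psi X hω n f = tailFrom y n := by
    intro n
    rw [hf, map_sub, ContinuousLinearMap.map_tsum _ hys]
    have : ∀ v, (ω v : ℂ) * (ω v : ℂ)⁻¹ = 1 := fun v => mul_inv_cancel₀ (hω.ne v)
    simp only [map_smul, psi, func_bas, smul_eq_mul, psiFun, hu, wl_one, mul_ite, this, mul_one,
      mul_zero, not_lt_zero, if_false, sub_zero]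
    have hs : Summable fun m => if n + 1 < m + 1 then y m else 0 := by
      have := hy1.indicator {m | n + 1 < m + 1}
      exact this.congr fun m => by simp [Set.indicator_apply]
    rw [← hs.sum_add_tsum_nat_add (n + 1), Finset.sum_eq_zero, zero_add, tailFrom]
    · refine tsum_congr fun j => ?_
      rw [if_pos (by omega), add_comm]
    · intro m hm
      have := Finset.mem_range.1 hm
      rw [if_neg (by omega)]
  obtain ⟨n, x, F, hrep⟩ := exists_fin_rep hω hfg
  obtain ⟨a, ha⟩ := hrep f haug
  have hgood : Good X hω f := by
    rw [ha]
    exact Good.sum _ _ fun i _ => Good.sum _ _ fun t _ =>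
      (good_all hXsym hXgen hω t (a i)).smul (x i t)
  refine Summable.congr hgood fun n => ?_
  rw [hpsi]

/-- Theorem 6.5: let `G` be an infinite group generated by a finite symmetric set `X`,
and let `ω` be a weight on `G`.  Put `τ n = min {ω(u) : |u| = n+1}` (0-indexed; the
minimum over the sphere `S_{n+1}`, here written as an infimum).  If `ℓ¹₀(G, ω)` is
finitely generated as a left ideal of `ℓ¹(G, ω)`, then `(τₙ)` is tail-preserving. -/
theorem stmt12 [Group G] [Infinite G] (X : Finset G)
    (hXsym : ∀ x ∈ X, x⁻¹ ∈ X) (hXgen : Subgroup.closure (X : Set G) = ⊤)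
    (ω : G → ℝ) (hω : IsWeight ω)
    (hfg : IsFinGenLeftIdealOf ω (l1w0 ω)) :
    TailPreserving (fun n => sInf (ω '' {u : G | wordLength (X : Set G) u = n + 1})) := by
  exact final X hXsym hXgen ω hω hfg
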